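/- arXiv:2305.11646 — 5 statements merged into one kernel-verified Lean document; each statement's English description precedes it below -/
import Mathlib

section
/- Let V be a real Hilbert space with a Hilbert basis (e_k)_{k∈ι}, let A : V → V be a continuous linear map, and let λ : ι → ℝ satisfy λ_k > 0 and A e_k = λ_k • e_k for every k ∈ ι. Let α, β ∈ ℝ. Then there exists u ∈ V with u ≠ 0 and A(A u) − β • (A u) − α • u = 0 if and only if there exists k ∈ ι such that α/λ_k² + β/λ_k = 1. -/
theorem inner_A_aux {V : Type*} [NormedAddCommGroup V] [InnerProductSpace ℝ V] [CompleteSpace V]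
    {ι : Type*} (e : HilbertBasis ι ℝ V) (A : V →L[ℝ] V) (lam : ι → ℝ)
    (hA : ∀ k, A (e k) = lam k • e k) (k : ι) (u : V) :
    inner ℝ (e k) (A u) = lam k * inner ℝ (e k) u := by
  classical
  have hd : Dense (Submodule.span ℝ (Set.range e) : Set V) :=
    (Submodule.dense_iff_topologicalClosure_eq_top).2 e.dense_span
  have h : (innerSL ℝ (e k)).comp A = lam k • innerSL ℝ (e k) := by
    refine ContinuousLinearMap.ext_on hd ?_
    rintro _ ⟨j, rfl⟩
    have ho := orthonormal_iff_ite.1 e.orthonormal k j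
    simp only [ContinuousLinearMap.comp_apply, ContinuousLinearMap.smul_apply, innerSL_apply_apply,
      hA, inner_smul_right, smul_eq_mul, ho]
    split_ifs with hkj
    · rw [hkj]
    · simp
  simpa using congrArg (fun f => f u) h

/-- Abstract operator form of the eigenvalue proposition: the fourth-order
equation `A² u - β A u - α u = 0` has a nontrivial solution iff
`α/λ_k² + β/λ_k = 1` for some `k`. -/
theorem stmt_0 {V : Type*} [NormedAddCommGroup V] [InnerProductSpace ℝ V] [CompleteSpace V]
    {ι : Type*} (e : HilbertBasis ι ℝ V) (A : V →L[ℝ] V) (lam : ι → ℝ)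
    (hlam : ∀ k, 0 < lam k) (hA : ∀ k, A (e k) = lam k • e k) (α β : ℝ) :
    (∃ u : V, u ≠ 0 ∧ A (A u) - β • A u - α • u = 0) ↔
      ∃ k : ι, α / (lam k) ^ 2 + β / lam k = 1 := by
  have key : ∀ k, α / (lam k) ^ 2 + β / lam k = 1 ↔ lam k * lam k - β * lam k - α = 0 := by
    intro k
    have h := (hlam k).ne'
    have h2 : α / (lam k) ^ 2 + β / lam k = (α + β * lam k) / (lam k) ^ 2 := by
      field_simp
    rw [h2, div_eq_one_iff_eq (pow_ne_zero 2 h)]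
    constructor <;> intro h3 <;> linarith
  constructor
  · rintro ⟨u, hu, h⟩
    have hex : ∃ k, inner ℝ (e k) u ≠ 0 := by
      by_contra! hc
      apply hu
      apply e.repr.injective
      ext k
      rw [e.repr_apply_apply, hc k]
      simp
    obtain ⟨k, hk⟩ := hex
    refine ⟨k, (key k).2 ?_⟩
    have h1 : inner ℝ (e k) (A (A u) - β • A u - α • u) = 0 := by rw [h, inner_zero_right]
    simp only [inner_sub_right, inner_smul_right, inner_A_aux e A lam hA] at h1
    refine (mul_eq_zero.1 ?_).resolve_right hk
    linarith
  · rintro ⟨k, hk⟩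
    refine ⟨e k, e.orthonormal.ne_zero k, ?_⟩
    rw [hA, map_smul, hA, smul_smul, smul_smul, ← sub_smul, ← sub_smul, (key k).1 hk, zero_smul]
end

section
/- Let G₁, G₂ : K × K → ℝ be continuous with G₁(x,τ) ≥ 0 and G₂(x,τ) ≥ 0 for all x, τ ∈ K, let δ₁, δ₂ > 0, and let ψ₁, ψ₂ : K → ℝ be continuous functions such that G_i(x,τ) ≥ δ_i ψ_i(x)² √(G_i(τ,τ)) for i = 1,2 and all x, τ ∈ K. Let h : K → ℝ be continuous with h ≥ 0, and define u(x) = ∫_Ω ∫_Ω G₁(x,τ) G₂(τ,s) h(s) ds dτ for x ∈ K. Then for every x ∈ K, u(x) ≥ δ₁ δ₂ ψ₁(x)² C₀ ∫_Ω √(G₂(s,s)) h(s) ds, where C₀ = ∫_Ω √(G₁(τ,τ)) ψ₂(τ)² dτ. -/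
open MeasureTheory Set

/-- Lower estimate in the proof of Lemma 4.1:
`u(x) ≥ δ₁ δ₂ ψ₁(x)² C₀ ∫_Ω √(G₂(s,s)) h(s) ds`, where
`C₀ = ∫_Ω √(G₁(τ,τ)) ψ₂(τ)² dτ` and
`u(x) = ∫_Ω ∫_Ω G₁(x,τ) G₂(τ,s) h(s) ds dτ`. -/
theorem stmt_5 {n : ℕ} (Ω : Set (EuclideanSpace ℝ (Fin n)))
    (hΩo : IsOpen Ω) (hΩne : Ω.Nonempty) (hΩb : Bornology.IsBounded Ω)
    (G₁ G₂ : EuclideanSpace ℝ (Fin n) → EuclideanSpace ℝ (Fin n) → ℝ)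
    (hG₁c : ContinuousOn (fun p => G₁ p.1 p.2) (closure Ω ×ˢ closure Ω))
    (hG₂c : ContinuousOn (fun p => G₂ p.1 p.2) (closure Ω ×ˢ closure Ω))
    (hG₁0 : ∀ x ∈ closure Ω, ∀ τ ∈ closure Ω, 0 ≤ G₁ x τ)
    (hG₂0 : ∀ x ∈ closure Ω, ∀ τ ∈ closure Ω, 0 ≤ G₂ x τ)
    (δ₁ δ₂ : ℝ) (hδ₁ : 0 < δ₁) (hδ₂ : 0 < δ₂)
    (ψ₁ ψ₂ : EuclideanSpace ℝ (Fin n) → ℝ)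
    (hψ₁c : ContinuousOn ψ₁ (closure Ω)) (hψ₂c : ContinuousOn ψ₂ (closure Ω))
    (hG₁lb : ∀ x ∈ closure Ω, ∀ τ ∈ closure Ω, δ₁ * ψ₁ x ^ 2 * Real.sqrt (G₁ τ τ) ≤ G₁ x τ)
    (hG₂lb : ∀ x ∈ closure Ω, ∀ τ ∈ closure Ω, δ₂ * ψ₂ x ^ 2 * Real.sqrt (G₂ τ τ) ≤ G₂ x τ)
    (h : EuclideanSpace ℝ (Fin n) → ℝ) (hhc : ContinuousOn h (closure Ω))
    (hh0 : ∀ x ∈ closure Ω, 0 ≤ h x)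
    (u : EuclideanSpace ℝ (Fin n) → ℝ)
    (hu : ∀ x, u x = ∫ τ in Ω, ∫ s in Ω, G₁ x τ * G₂ τ s * h s)
    (C₀ : ℝ) (hC₀ : C₀ = ∫ τ in Ω, Real.sqrt (G₁ τ τ) * ψ₂ τ ^ 2) :
    ∀ x ∈ closure Ω,
      δ₁ * δ₂ * ψ₁ x ^ 2 * C₀ * ∫ s in Ω, Real.sqrt (G₂ s s) * h s ≤ u x := by
  intro x hx
  have hK : IsCompact (closure Ω) := hΩb.isCompact_closure
  have hsub : Ω ⊆ closure Ω := subset_closure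
  have hdiag : ContinuousOn (fun y : EuclideanSpace ℝ (Fin n) => (y, y)) (closure Ω) := by
    fun_prop
  have hD₁ : ContinuousOn (fun τ => G₁ τ τ) (closure Ω) :=
    hG₁c.comp hdiag (fun y hy => ⟨hy, hy⟩)
  have hD₂ : ContinuousOn (fun τ => G₂ τ τ) (closure Ω) :=
    hG₂c.comp hdiag (fun y hy => ⟨hy, hy⟩)
  have hi₂ : IntegrableOn (fun s => Real.sqrt (G₂ s s) * h s) Ω :=
    ((hD₂.sqrt.mul hhc).integrableOn_compact hK).mono_set hsub
  have hi₁ : IntegrableOn (fun s => Real.sqrt (G₁ s s) * ψ₂ s ^ 2) Ω :=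
    ((hD₁.sqrt.mul (hψ₂c.pow 2)).integrableOn_compact hK).mono_set hsub
  have hF : ContinuousOn (fun p : EuclideanSpace ℝ (Fin n) × EuclideanSpace ℝ (Fin n) =>
      G₁ x p.1 * G₂ p.1 p.2 * h p.2) (closure Ω ×ˢ closure Ω) := by
    refine ContinuousOn.mul (ContinuousOn.mul ?_ hG₂c) ?_
    · exact hG₁c.comp (f := fun p : EuclideanSpace ℝ (Fin n) × EuclideanSpace ℝ (Fin n) =>
        (x, p.1)) (by fun_prop) (fun p hp => ⟨hx, hp.1⟩)
    · exact hhc.comp continuousOn_snd (fun p hp => hp.2)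
  have hFi : Integrable (fun p : EuclideanSpace ℝ (Fin n) × EuclideanSpace ℝ (Fin n) =>
      G₁ x p.1 * G₂ p.1 p.2 * h p.2)
      ((volume.restrict Ω).prod (volume.restrict Ω)) := by
    rw [Measure.prod_restrict]
    exact (hF.integrableOn_compact (μ := volume.prod volume) (hK.prod hK)).mono_set
      (prod_mono hsub hsub)
  have hout := hFi.integral_prod_left
  rw [hu, hC₀]
  have e : δ₁ * δ₂ * ψ₁ x ^ 2 * (∫ τ in Ω, Real.sqrt (G₁ τ τ) * ψ₂ τ ^ 2)
        * (∫ s in Ω, Real.sqrt (G₂ s s) * h s)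
      = ∫ τ in Ω, (δ₁ * δ₂ * ψ₁ x ^ 2 * (∫ s in Ω, Real.sqrt (G₂ s s) * h s)) *
          (Real.sqrt (G₁ τ τ) * ψ₂ τ ^ 2) := by
    rw [integral_const_mul]; ring
  rw [e]
  refine setIntegral_mono_on (hi₁.const_mul _) hout hΩo.measurableSet ?_
  intro τ hτ
  have hτ' := hsub hτ
  have e2 : (δ₁ * δ₂ * ψ₁ x ^ 2 * (∫ s in Ω, Real.sqrt (G₂ s s) * h s)) *
          (Real.sqrt (G₁ τ τ) * ψ₂ τ ^ 2)
      = ∫ s in Ω, (δ₁ * ψ₁ x ^ 2 * Real.sqrt (G₁ τ τ) * (δ₂ * ψ₂ τ ^ 2)) *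
          (Real.sqrt (G₂ s s) * h s) := by
    rw [integral_const_mul]; ring
  rw [e2]
  refine setIntegral_mono_on (hi₂.const_mul _) ?_ hΩo.measurableSet ?_
  · have hc : ContinuousOn (fun s => G₁ x τ * G₂ τ s * h s) (closure Ω) :=
      hF.comp (f := fun s => (τ, s)) (by fun_prop) (fun s hs => ⟨hτ', hs⟩)
    exact (hc.integrableOn_compact hK).mono_set hsub
  · intro s hs
    have hs' := hsub hs
    have h1 := hG₁lb x hx τ hτ'
    have h2 := hG₂lb τ hτ' s hs'
    have h3 := mul_le_mul_of_nonneg_right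
      (mul_le_mul h1 h2 (by positivity) (hG₁0 x hx τ hτ')) (hh0 s hs')
    calc _ = _ := by ring
      _ ≤ _ := h3
end

section
/- Let G₁, G₂ : K × K → ℝ be continuous with G₁(x,τ) ≥ 0 and G₂(x,τ) ≥ 0 for all x, τ ∈ K, and suppose there are constants C₁, C₂, δ₁, δ₂ > 0, M₁ > 0 and continuous functions ψ₁, ψ₂ : K → ℝ such that for i = 1,2 and all x, τ ∈ K: G_i(x,τ) ≤ C_i √(G_i(τ,τ)), G_i(x,τ) ≥ δ_i ψ_i(x)² √(G_i(τ,τ)), and G₁(τ,τ) ≤ M₁. Let h : K → ℝ be continuous with h ≥ 0 and define u(x) = ∫_Ω ∫_Ω G₁(x,τ) G₂(τ,s) h(s) ds dτ. Then for every x ∈ K, u(x) ≥ (δ₁ δ₂ C₀ ψ₁(x)² / (C₁ C₂ |Ω| √(M₁))) · sup_{y∈K} u(y), where C₀ = ∫_Ω √(G₁(τ,τ)) ψ₂(τ)² dτ. -/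
open MeasureTheory Set

/-- Abstract form of Lemma 2.2 (estimate (2.8)): the solution
`u(x) = ∫_Ω ∫_Ω G₁(x,τ) G₂(τ,s) h(s) ds dτ` satisfies
`u(x) ≥ (δ₁ δ₂ C₀ ψ₁(x)² / (C₁ C₂ |Ω| √M₁)) ‖u‖`. -/
theorem stmt_6 {n : ℕ} (Ω : Set (EuclideanSpace ℝ (Fin n)))
    (hΩo : IsOpen Ω) (hΩne : Ω.Nonempty) (hΩb : Bornology.IsBounded Ω)
    (G₁ G₂ : EuclideanSpace ℝ (Fin n) → EuclideanSpace ℝ (Fin n) → ℝ)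
    (hG₁c : ContinuousOn (fun p => G₁ p.1 p.2) (closure Ω ×ˢ closure Ω))
    (hG₂c : ContinuousOn (fun p => G₂ p.1 p.2) (closure Ω ×ˢ closure Ω))
    (hG₁0 : ∀ x ∈ closure Ω, ∀ τ ∈ closure Ω, 0 ≤ G₁ x τ)
    (hG₂0 : ∀ x ∈ closure Ω, ∀ τ ∈ closure Ω, 0 ≤ G₂ x τ)
    (C₁ C₂ δ₁ δ₂ M₁ : ℝ) (hC₁ : 0 < C₁) (hC₂ : 0 < C₂)
    (hδ₁ : 0 < δ₁) (hδ₂ : 0 < δ₂) (hM₁ : 0 < M₁)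
    (ψ₁ ψ₂ : EuclideanSpace ℝ (Fin n) → ℝ)
    (hψ₁c : ContinuousOn ψ₁ (closure Ω)) (hψ₂c : ContinuousOn ψ₂ (closure Ω))
    (hG₁bd : ∀ x ∈ closure Ω, ∀ τ ∈ closure Ω, G₁ x τ ≤ C₁ * Real.sqrt (G₁ τ τ))
    (hG₂bd : ∀ x ∈ closure Ω, ∀ τ ∈ closure Ω, G₂ x τ ≤ C₂ * Real.sqrt (G₂ τ τ))
    (hG₁lb : ∀ x ∈ closure Ω, ∀ τ ∈ closure Ω, δ₁ * ψ₁ x ^ 2 * Real.sqrt (G₁ τ τ) ≤ G₁ x τ)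
    (hG₂lb : ∀ x ∈ closure Ω, ∀ τ ∈ closure Ω, δ₂ * ψ₂ x ^ 2 * Real.sqrt (G₂ τ τ) ≤ G₂ x τ)
    (hG₁M : ∀ τ ∈ closure Ω, G₁ τ τ ≤ M₁)
    (h : EuclideanSpace ℝ (Fin n) → ℝ) (hhc : ContinuousOn h (closure Ω))
    (hh0 : ∀ x ∈ closure Ω, 0 ≤ h x)
    (u : EuclideanSpace ℝ (Fin n) → ℝ)
    (hu : ∀ x, u x = ∫ τ in Ω, ∫ s in Ω, G₁ x τ * G₂ τ s * h s)
    (C₀ : ℝ) (hC₀ : C₀ = ∫ τ in Ω, Real.sqrt (G₁ τ τ) * ψ₂ τ ^ 2) :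
    ∀ x ∈ closure Ω,
      δ₁ * δ₂ * C₀ * ψ₁ x ^ 2 / (C₁ * C₂ * (volume Ω).toReal * Real.sqrt M₁) *
          sSup (u '' closure Ω) ≤ u x := by
  intro x hx
  have hKc : IsCompact (closure Ω) := hΩb.isCompact_closure
  have hsub : Ω ⊆ closure Ω := subset_closure
  have hΩm : MeasurableSet Ω := hΩo.measurableSet
  have hfin : volume Ω ≠ ⊤ := hΩb.measure_lt_top.ne
  have hvol : 0 < (volume Ω).toReal :=
    ENNReal.toReal_pos (hΩo.measure_pos volume hΩne).ne' hfin
  have hint : ∀ f : EuclideanSpace ℝ (Fin n) → ℝ, ContinuousOn f (closure Ω) →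
      IntegrableOn f Ω := fun f hf =>
    (hf.integrableOn_compact hKc).mono_set hsub
  have hd₁ : ContinuousOn (fun τ => Real.sqrt (G₁ τ τ)) (closure Ω) :=
    (hG₁c.comp (f := fun τ => (τ, τ)) (by fun_prop) (fun τ hτ => ⟨hτ, hτ⟩)).sqrt
  have hd₂ : ContinuousOn (fun τ => Real.sqrt (G₂ τ τ)) (closure Ω) :=
    (hG₂c.comp (f := fun τ => (τ, τ)) (by fun_prop) (fun τ hτ => ⟨hτ, hτ⟩)).sqrt
  have hG₁x : ∀ y ∈ closure Ω, ContinuousOn (fun τ => G₁ y τ) (closure Ω) := fun y hy =>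
    hG₁c.comp (f := fun τ => (y, τ)) (by fun_prop) (fun τ hτ => ⟨hy, hτ⟩)
  have hG₂x : ∀ y ∈ closure Ω, ContinuousOn (fun τ => G₂ y τ) (closure Ω) := fun y hy =>
    hG₂c.comp (f := fun τ => (y, τ)) (by fun_prop) (fun τ hτ => ⟨hy, hτ⟩)
  have houter : ∀ y ∈ closure Ω,
      IntegrableOn (fun τ => ∫ s in Ω, G₁ y τ * G₂ τ s * h s) Ω := by
    intro y hy
    have hc : ContinuousOn
        (fun p : EuclideanSpace ℝ (Fin n) × EuclideanSpace ℝ (Fin n) =>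
          G₁ y p.1 * G₂ p.1 p.2 * h p.2) (closure Ω ×ˢ closure Ω) := by
      refine ContinuousOn.mul (ContinuousOn.mul ?_ hG₂c) ?_
      · exact (hG₁x y hy).comp continuousOn_fst (fun p hp => hp.1)
      · exact hhc.comp continuousOn_snd (fun p hp => hp.2)
    have hi := (hc.integrableOn_compact (μ := volume.prod volume) (hKc.prod hKc)).mono_set
      (prod_mono hsub hsub)
    rw [IntegrableOn, ← Measure.prod_restrict] at hi
    exact hi.integral_prod_left
  set H : ℝ := ∫ s in Ω, Real.sqrt (G₂ s s) * h s with hH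
  have hHi : IntegrableOn (fun s => Real.sqrt (G₂ s s) * h s) Ω := hint _ (hd₂.mul hhc)
  have hH0 : 0 ≤ H := setIntegral_nonneg hΩm fun s hs =>
    mul_nonneg (Real.sqrt_nonneg _) (hh0 s (hsub hs))
  have hgi : ∀ τ ∈ closure Ω, IntegrableOn (fun s => G₂ τ s * h s) Ω := fun τ hτ =>
    hint _ ((hG₂x τ hτ).mul hhc)
  have hpull : ∀ y τ, ∫ s in Ω, G₁ y τ * G₂ τ s * h s = G₁ y τ * ∫ s in Ω, G₂ τ s * h s := by
    intro y τ
    simp_rw [mul_assoc]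
    exact integral_const_mul _ _
  have hgup : ∀ τ ∈ closure Ω, ∫ s in Ω, G₂ τ s * h s ≤ C₂ * H := by
    intro τ hτ
    rw [hH, ← integral_const_mul]
    refine setIntegral_mono_on (hgi τ hτ) (hHi.const_mul _) hΩm fun s hs => ?_
    rw [← mul_assoc]
    exact mul_le_mul_of_nonneg_right (hG₂bd τ hτ s (hsub hs)) (hh0 s (hsub hs))
  have hglo : ∀ τ ∈ closure Ω, δ₂ * ψ₂ τ ^ 2 * H ≤ ∫ s in Ω, G₂ τ s * h s := by
    intro τ hτ
    rw [hH, ← integral_const_mul]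
    refine setIntegral_mono_on (hHi.const_mul _) (hgi τ hτ) hΩm fun s hs => ?_
    rw [← mul_assoc]
    exact mul_le_mul_of_nonneg_right (hG₂lb τ hτ s (hsub hs)) (hh0 s (hsub hs))
  have hup : ∀ y ∈ closure Ω, u y ≤ C₁ * C₂ * (volume Ω).toReal * Real.sqrt M₁ * H := by
    intro y hy
    rw [hu]
    have hle : ∫ τ in Ω, ∫ s in Ω, G₁ y τ * G₂ τ s * h s
        ≤ ∫ τ in Ω, (C₁ * Real.sqrt M₁) * (C₂ * H) := by
      refine setIntegral_mono_on (houter y hy) (integrableOn_const hfin) hΩm fun τ hτ => ?_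
      have hτ' := hsub hτ
      rw [hpull]
      have h1 : G₁ y τ ≤ C₁ * Real.sqrt M₁ := (hG₁bd y hy τ hτ').trans
        (mul_le_mul_of_nonneg_left (Real.sqrt_le_sqrt (hG₁M τ hτ')) hC₁.le)
      exact (mul_le_mul_of_nonneg_left (hgup τ hτ') (hG₁0 y hy τ hτ')).trans
        (mul_le_mul_of_nonneg_right h1 (by positivity))
    refine hle.trans (le_of_eq ?_)
    rw [setIntegral_const, smul_eq_mul, Measure.real]
    ring
  have hlo : δ₁ * δ₂ * C₀ * ψ₁ x ^ 2 * H ≤ u x := by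
    rw [hu]
    have hle : ∫ τ in Ω, (δ₁ * δ₂ * ψ₁ x ^ 2 * H) * (Real.sqrt (G₁ τ τ) * ψ₂ τ ^ 2)
        ≤ ∫ τ in Ω, ∫ s in Ω, G₁ x τ * G₂ τ s * h s := by
      refine setIntegral_mono_on ((hint _ (hd₁.mul (hψ₂c.pow 2))).const_mul _)
        (houter x hx) hΩm fun τ hτ => ?_
      have hτ' := hsub hτ
      rw [hpull]
      calc _ = (δ₁ * ψ₁ x ^ 2 * Real.sqrt (G₁ τ τ)) * (δ₂ * ψ₂ τ ^ 2 * H) := by ring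
        _ ≤ G₁ x τ * (δ₂ * ψ₂ τ ^ 2 * H) :=
          mul_le_mul_of_nonneg_right (hG₁lb x hx τ hτ') (by positivity)
        _ ≤ _ := mul_le_mul_of_nonneg_left (hglo τ hτ') (hG₁0 x hx τ hτ')
    rw [integral_const_mul, ← hC₀] at hle
    refine le_trans (le_of_eq ?_) hle
    ring
  have hC₀0 : 0 ≤ C₀ := by
    rw [hC₀]
    exact setIntegral_nonneg hΩm fun s _ => by positivity
  have hsup : sSup (u '' closure Ω) ≤ C₁ * C₂ * (volume Ω).toReal * Real.sqrt M₁ * H := by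
    refine csSup_le (hΩne.closure.image u) ?_
    rintro _ ⟨y, hy, rfl⟩
    exact hup y hy
  have hD : 0 < C₁ * C₂ * (volume Ω).toReal * Real.sqrt M₁ := by
    have := Real.sqrt_pos.2 hM₁
    positivity
  refine (mul_le_mul_of_nonneg_left hsup (by positivity)).trans (le_trans (le_of_eq ?_) hlo)
  rw [← mul_assoc, div_mul_cancel₀ _ hD.ne']
end

section
/- For j = 1,2, let G_{1,j}, G_{2,j} : K × K → ℝ be continuous nonnegative kernels, let C_{1,j}, C_{2,j}, δ_{1,j}, δ_{2,j} > 0 be constants and ψ_{1,j}, ψ_{2,j} : K → ℝ continuous functions such that for i = 1,2 and all x, τ ∈ K: G_{i,j}(x,τ) ≤ C_{i,j} √(G_{i,j}(τ,τ)) and G_{i,j}(x,τ) ≥ δ_{i,j} ψ_{i,j}(x)² √(G_{i,j}(τ,τ)); assume M_{1,j} := sup_{τ∈K} G_{1,j}(τ,τ) > 0. Let f₁, f₂ : K × ℝ × ℝ → ℝ be continuous and nonnegative, let Ω₀ be a nonempty compact subset of Ω, and set m_{1,j} = inf_{x∈Ω₀} ψ_{1,j}(x)², C_{0,j} = ∫_Ω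 √(G_{1,j}(τ,τ)) ψ_{2,j}(τ)² dτ, σ_j = δ_{1,j}δ_{2,j} m_{1,j} C_{0,j} / (C_{1,j}C_{2,j} √(M_{1,j}) |Ω|), and σ = min{σ₁, σ₂}. Define T_j(u₁,u₂)(x) = ∫_Ω ∫_Ω G_{1,j}(x,τ) G_{2,j}(τ,s) f_j(s, u₁(s), u₂(s)) ds dτ. Then for all continuous u₁, u₂ : K → ℝ and all x ∈ Ω₀, T₁(u₁,u₂)(x) + T₂(u₁,u₂)(x) ≥ σ·(sup_{y∈K} T₁(u₁,u₂)(y) + sup_{y∈K} T₂(u₁,u₂)(y)). -/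
open MeasureTheory Set

theorem cone_aux {n : ℕ} (Ω Ω₀ : Set (EuclideanSpace ℝ (Fin n)))
    (hΩo : IsOpen Ω) (hΩne : Ω.Nonempty) (hΩb : Bornology.IsBounded Ω)
    (hΩ₀sub : Ω₀ ⊆ Ω) (hΩ₀ne : Ω₀.Nonempty)
    (G H : EuclideanSpace ℝ (Fin n) → EuclideanSpace ℝ (Fin n) → ℝ)
    (hGc : ContinuousOn (fun p => G p.1 p.2) (closure Ω ×ˢ closure Ω))
    (hHc : ContinuousOn (fun p => H p.1 p.2) (closure Ω ×ˢ closure Ω))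
    (hG0 : ∀ x ∈ closure Ω, ∀ τ ∈ closure Ω, 0 ≤ G x τ)
    (hH0 : ∀ x ∈ closure Ω, ∀ τ ∈ closure Ω, 0 ≤ H x τ)
    (C D δ ε : ℝ) (hC : 0 < C) (hD : 0 < D) (hδ : 0 < δ) (hε : 0 < ε)
    (ψ φ : EuclideanSpace ℝ (Fin n) → ℝ)
    (hφc : ContinuousOn φ (closure Ω))
    (hGbd : ∀ x ∈ closure Ω, ∀ τ ∈ closure Ω, G x τ ≤ C * Real.sqrt (G τ τ))
    (hHbd : ∀ x ∈ closure Ω, ∀ τ ∈ closure Ω, H x τ ≤ D * Real.sqrt (H τ τ))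
    (hGlb : ∀ x ∈ closure Ω, ∀ τ ∈ closure Ω, δ * ψ x ^ 2 * Real.sqrt (G τ τ) ≤ G x τ)
    (hHlb : ∀ x ∈ closure Ω, ∀ τ ∈ closure Ω, ε * φ x ^ 2 * Real.sqrt (H τ τ) ≤ H x τ)
    (M : ℝ) (hM : M = sSup ((fun τ => G τ τ) '' closure Ω)) (hMpos : 0 < M)
    (f : EuclideanSpace ℝ (Fin n) → ℝ → ℝ → ℝ)
    (hfc : ContinuousOn (fun p : EuclideanSpace ℝ (Fin n) × ℝ × ℝ =>
      f p.1 p.2.1 p.2.2) (closure Ω ×ˢ univ))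
    (hf0 : ∀ x ∈ closure Ω, ∀ v₁ v₂ : ℝ, 0 ≤ f x v₁ v₂)
    (m C₀ σ : ℝ)
    (hm : m = sInf ((fun x => ψ x ^ 2) '' Ω₀))
    (hC₀ : C₀ = ∫ τ in Ω, Real.sqrt (G τ τ) * φ τ ^ 2)
    (hσ : σ = δ * ε * m * C₀ / (C * D * Real.sqrt M * (volume Ω).toReal))
    (u₁ u₂ : EuclideanSpace ℝ (Fin n) → ℝ)
    (hu₁ : ContinuousOn u₁ (closure Ω)) (hu₂ : ContinuousOn u₂ (closure Ω))
    (T : EuclideanSpace ℝ (Fin n) → ℝ)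
    (hT : ∀ x, T x = ∫ τ in Ω, ∫ s in Ω, G x τ * H τ s * f s (u₁ s) (u₂ s)) :
    0 ≤ sSup (T '' closure Ω) ∧ ∀ x ∈ Ω₀, σ * sSup (T '' closure Ω) ≤ T x := by
  have hK : IsCompact (closure Ω) := hΩb.isCompact_closure
  have hsub : Ω ⊆ closure Ω := subset_closure
  have hms : MeasurableSet Ω := hΩo.measurableSet
  have hvt : volume Ω < ⊤ := hΩb.measure_lt_top
  have hvpos : 0 < (volume Ω).toReal :=
    ENNReal.toReal_pos (hΩo.measure_pos volume hΩne).ne' hvt.ne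
  have hdiag : ContinuousOn (fun τ : EuclideanSpace ℝ (Fin n) => (τ, τ)) (closure Ω) := by fun_prop
  have hGd : ContinuousOn (fun τ => G τ τ) (closure Ω) :=
    hGc.comp hdiag (fun τ h => ⟨h, h⟩)
  have hHd : ContinuousOn (fun τ => H τ τ) (closure Ω) :=
    hHc.comp hdiag (fun τ h => ⟨h, h⟩)
  set F : EuclideanSpace ℝ (Fin n) → ℝ := fun s => f s (u₁ s) (u₂ s) with hF
  have hFc : ContinuousOn F (closure Ω) :=
    hfc.comp (f := fun s => (s, u₁ s, u₂ s))
      (continuousOn_id.prodMk (hu₁.prodMk hu₂)) (fun s h => ⟨h, mem_univ _⟩)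
  have hF0 : ∀ s ∈ closure Ω, 0 ≤ F s := fun s h => hf0 s h _ _
  have hint : ∀ g : EuclideanSpace ℝ (Fin n) → ℝ, ContinuousOn g (closure Ω) →
      IntegrableOn g Ω := fun g hg => (hg.integrableOn_compact hK).mono_set hsub
  have hGs : ∀ x ∈ closure Ω, ContinuousOn (fun τ => G x τ) (closure Ω) := fun x hx =>
    hGc.comp (f := fun τ => (x, τ)) (by fun_prop) (fun τ h => ⟨hx, h⟩)
  have hHs : ∀ x ∈ closure Ω, ContinuousOn (fun τ => H x τ) (closure Ω) := fun x hx =>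
    hHc.comp (f := fun τ => (x, τ)) (by fun_prop) (fun τ h => ⟨hx, h⟩)
  set A : ℝ := ∫ s in Ω, Real.sqrt (H s s) * F s with hA
  have hAc : ContinuousOn (fun s => Real.sqrt (H s s) * F s) (closure Ω) := hHd.sqrt.mul hFc
  have hA0 : 0 ≤ A := setIntegral_nonneg hms fun s hs =>
    mul_nonneg (Real.sqrt_nonneg _) (hF0 s (hsub hs))
  have hGM : ∀ τ ∈ closure Ω, Real.sqrt (G τ τ) ≤ Real.sqrt M := fun τ h => by
    apply Real.sqrt_le_sqrt
    rw [hM]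
    exact le_csSup (hK.bddAbove_image hGd) (mem_image_of_mem _ h)
  have hinner : ∀ x ∈ closure Ω, ∀ τ ∈ closure Ω,
      IntegrableOn (fun s => G x τ * H τ s * F s) Ω := fun x hx τ hτ =>
    hint _ ((continuousOn_const.mul (hHs τ hτ)).mul hFc)
  have hin0 : ∀ x ∈ closure Ω, ∀ τ ∈ closure Ω, 0 ≤ ∫ s in Ω, G x τ * H τ s * F s :=
    fun x hx τ hτ => setIntegral_nonneg hms fun s hs =>
      mul_nonneg (mul_nonneg (hG0 x hx τ hτ) (hH0 τ hτ s (hsub hs))) (hF0 s (hsub hs))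
  have hT0 : ∀ x ∈ closure Ω, 0 ≤ T x := fun x hx => by
    rw [hT]
    exact setIntegral_nonneg hms fun τ hτ => hin0 x hx τ (hsub hτ)
  have hTub : ∀ x ∈ closure Ω, T x ≤ C * D * Real.sqrt M * (volume Ω).toReal * A := by
    intro x hx
    have h1 : ∀ τ ∈ Ω, ‖∫ s in Ω, G x τ * H τ s * F s‖ ≤ C * D * Real.sqrt M * A := by
      intro τ hτ
      rw [Real.norm_of_nonneg (hin0 x hx τ (hsub hτ)), hA, ← integral_const_mul]
      refine setIntegral_mono_on (hinner x hx τ (hsub hτ)) ((hint _ hAc).const_mul _) hms ?_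
      intro s hs
      have a1 : G x τ ≤ C * Real.sqrt M := (hGbd x hx τ (hsub hτ)).trans
        (mul_le_mul_of_nonneg_left (hGM τ (hsub hτ)) hC.le)
      have a2 := hHbd τ (hsub hτ) s (hsub hs)
      have a3 := mul_le_mul a1 a2 (hH0 τ (hsub hτ) s (hsub hs)) (by positivity)
      have a4 := mul_le_mul_of_nonneg_right a3 (hF0 s (hsub hs))
      calc _ ≤ _ := a4
        _ = _ := by ring
    have h2 := norm_setIntegral_le_of_norm_le_const (μ := volume) hvt h1
    rw [hT]
    refine (le_abs_self _).trans (h2.trans (le_of_eq ?_))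
    simp only [Measure.real]
    ring
  have hne : (closure Ω).Nonempty := hΩne.mono hsub
  have hSub : sSup (T '' closure Ω) ≤ C * D * Real.sqrt M * (volume Ω).toReal * A :=
    csSup_le (hne.image _) (by rintro _ ⟨x, hx, rfl⟩; exact hTub x hx)
  have hS0 : 0 ≤ sSup (T '' closure Ω) :=
    Real.sSup_nonneg (by rintro _ ⟨x, hx, rfl⟩; exact hT0 x hx)
  refine ⟨hS0, ?_⟩
  have hm0 : 0 ≤ m := by
    rw [hm]
    exact Real.sInf_nonneg (by rintro _ ⟨x, hx, rfl⟩; positivity)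
  have hC0 : 0 ≤ C₀ := by
    rw [hC₀]
    exact setIntegral_nonneg hms fun s hs => by positivity
  have hsM : 0 < Real.sqrt M := Real.sqrt_pos.2 hMpos
  have hσ0 : 0 ≤ σ := by rw [hσ]; positivity
  intro x hx
  have hxK := hsub (hΩ₀sub hx)
  have hmx : m ≤ ψ x ^ 2 := by
    rw [hm]
    exact csInf_le ⟨0, by rintro _ ⟨y, hy, rfl⟩; positivity⟩ (mem_image_of_mem _ hx)
  have key : δ * ε * m * C₀ * A ≤ T x := by
    have e : δ * ε * m * C₀ * A =
        ∫ τ in Ω, (δ * ε * m * A) * (Real.sqrt (G τ τ) * φ τ ^ 2) := by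
      rw [integral_const_mul, ← hC₀]; ring
    rw [e, hT]
    refine setIntegral_mono_on ((hint _ (hGd.sqrt.mul (hφc.pow 2))).const_mul _) ?_ hms ?_
    · have hc : ContinuousOn (fun p : EuclideanSpace ℝ (Fin n) × EuclideanSpace ℝ (Fin n) =>
          G x p.1 * H p.1 p.2 * F p.2) (closure Ω ×ˢ closure Ω) := by
        refine (ContinuousOn.mul ?_ hHc).mul ?_
        · exact (hGs x hxK).comp continuousOn_fst (fun p hp => hp.1)
        · exact hFc.comp continuousOn_snd (fun p hp => hp.2)
      have hi : IntegrableOn (fun p : EuclideanSpace ℝ (Fin n) × EuclideanSpace ℝ (Fin n) =>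
          G x p.1 * H p.1 p.2 * F p.2) (Ω ×ˢ Ω) (volume.prod volume) :=
        (hc.integrableOn_compact (hK.prod hK)).mono_set (prod_mono hsub hsub)
      rw [IntegrableOn, ← Measure.prod_restrict] at hi
      exact hi.integral_prod_left
    · intro τ hτ
      have e2 : δ * ε * m * A * (Real.sqrt (G τ τ) * φ τ ^ 2) =
          ∫ s in Ω, (δ * ε * m * (Real.sqrt (G τ τ) * φ τ ^ 2)) * (Real.sqrt (H s s) * F s) := by
        rw [integral_const_mul, ← hA]; ring
      rw [e2]
      refine setIntegral_mono_on ((hint _ hAc).const_mul _) (hinner x hxK τ (hsub hτ)) hms ?_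
      intro s hs
      have a1 : δ * m * Real.sqrt (G τ τ) ≤ G x τ := by
        refine le_trans ?_ (hGlb x hxK τ (hsub hτ))
        gcongr
      have a2 := hHlb τ (hsub hτ) s (hsub hs)
      have a3 := mul_le_mul a1 a2 (by positivity) (hG0 x hxK τ (hsub hτ))
      have a4 := mul_le_mul_of_nonneg_right a3 (hF0 s (hsub hs))
      calc _ = _ := by ring
        _ ≤ _ := a4
  calc σ * sSup (T '' closure Ω) ≤ σ * (C * D * Real.sqrt M * (volume Ω).toReal * A) :=
        mul_le_mul_of_nonneg_left hSub hσ0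
    _ = δ * ε * m * C₀ * A := by rw [hσ]; field_simp
    _ ≤ T x := key

/-- Cone invariance `T(𝒫) ⊆ 𝒫` of Lemma 4.1: for all continuous `u₁, u₂` and
all `x ∈ Ω₀`, `T₁(u₁,u₂)(x) + T₂(u₁,u₂)(x) ≥ σ (‖T₁(u₁,u₂)‖ + ‖T₂(u₁,u₂)‖)`. -/
theorem stmt_9 {n : ℕ} (Ω Ω₀ : Set (EuclideanSpace ℝ (Fin n)))
    (hΩo : IsOpen Ω) (hΩne : Ω.Nonempty) (hΩb : Bornology.IsBounded Ω)
    (hΩ₀sub : Ω₀ ⊆ Ω) (hΩ₀ne : Ω₀.Nonempty) (hΩ₀c : IsCompact Ω₀)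
    (G₁₁ G₂₁ G₁₂ G₂₂ : EuclideanSpace ℝ (Fin n) → EuclideanSpace ℝ (Fin n) → ℝ)
    (hG₁₁c : ContinuousOn (fun p => G₁₁ p.1 p.2) (closure Ω ×ˢ closure Ω))
    (hG₂₁c : ContinuousOn (fun p => G₂₁ p.1 p.2) (closure Ω ×ˢ closure Ω))
    (hG₁₂c : ContinuousOn (fun p => G₁₂ p.1 p.2) (closure Ω ×ˢ closure Ω))
    (hG₂₂c : ContinuousOn (fun p => G₂₂ p.1 p.2) (closure Ω ×ˢ closure Ω))
    (hG₁₁0 : ∀ x ∈ closure Ω, ∀ τ ∈ closure Ω, 0 ≤ G₁₁ x τ)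
    (hG₂₁0 : ∀ x ∈ closure Ω, ∀ τ ∈ closure Ω, 0 ≤ G₂₁ x τ)
    (hG₁₂0 : ∀ x ∈ closure Ω, ∀ τ ∈ closure Ω, 0 ≤ G₁₂ x τ)
    (hG₂₂0 : ∀ x ∈ closure Ω, ∀ τ ∈ closure Ω, 0 ≤ G₂₂ x τ)
    (C₁₁ C₂₁ C₁₂ C₂₂ δ₁₁ δ₂₁ δ₁₂ δ₂₂ : ℝ)
    (hC₁₁ : 0 < C₁₁) (hC₂₁ : 0 < C₂₁) (hC₁₂ : 0 < C₁₂) (hC₂₂ : 0 < C₂₂)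
    (hδ₁₁ : 0 < δ₁₁) (hδ₂₁ : 0 < δ₂₁) (hδ₁₂ : 0 < δ₁₂) (hδ₂₂ : 0 < δ₂₂)
    (ψ₁₁ ψ₂₁ ψ₁₂ ψ₂₂ : EuclideanSpace ℝ (Fin n) → ℝ)
    (hψ₁₁c : ContinuousOn ψ₁₁ (closure Ω)) (hψ₂₁c : ContinuousOn ψ₂₁ (closure Ω))
    (hψ₁₂c : ContinuousOn ψ₁₂ (closure Ω)) (hψ₂₂c : ContinuousOn ψ₂₂ (closure Ω))
    (hG₁₁bd : ∀ x ∈ closure Ω, ∀ τ ∈ closure Ω, G₁₁ x τ ≤ C₁₁ * Real.sqrt (G₁₁ τ τ))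
    (hG₂₁bd : ∀ x ∈ closure Ω, ∀ τ ∈ closure Ω, G₂₁ x τ ≤ C₂₁ * Real.sqrt (G₂₁ τ τ))
    (hG₁₂bd : ∀ x ∈ closure Ω, ∀ τ ∈ closure Ω, G₁₂ x τ ≤ C₁₂ * Real.sqrt (G₁₂ τ τ))
    (hG₂₂bd : ∀ x ∈ closure Ω, ∀ τ ∈ closure Ω, G₂₂ x τ ≤ C₂₂ * Real.sqrt (G₂₂ τ τ))
    (hG₁₁lb : ∀ x ∈ closure Ω, ∀ τ ∈ closure Ω,
      δ₁₁ * ψ₁₁ x ^ 2 * Real.sqrt (G₁₁ τ τ) ≤ G₁₁ x τ)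
    (hG₂₁lb : ∀ x ∈ closure Ω, ∀ τ ∈ closure Ω,
      δ₂₁ * ψ₂₁ x ^ 2 * Real.sqrt (G₂₁ τ τ) ≤ G₂₁ x τ)
    (hG₁₂lb : ∀ x ∈ closure Ω, ∀ τ ∈ closure Ω,
      δ₁₂ * ψ₁₂ x ^ 2 * Real.sqrt (G₁₂ τ τ) ≤ G₁₂ x τ)
    (hG₂₂lb : ∀ x ∈ closure Ω, ∀ τ ∈ closure Ω,
      δ₂₂ * ψ₂₂ x ^ 2 * Real.sqrt (G₂₂ τ τ) ≤ G₂₂ x τ)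
    (M₁₁ M₁₂ : ℝ)
    (hM₁₁ : M₁₁ = sSup ((fun τ => G₁₁ τ τ) '' closure Ω)) (hM₁₁pos : 0 < M₁₁)
    (hM₁₂ : M₁₂ = sSup ((fun τ => G₁₂ τ τ) '' closure Ω)) (hM₁₂pos : 0 < M₁₂)
    (f₁ f₂ : EuclideanSpace ℝ (Fin n) → ℝ → ℝ → ℝ)
    (hf₁c : ContinuousOn (fun p : EuclideanSpace ℝ (Fin n) × ℝ × ℝ =>
      f₁ p.1 p.2.1 p.2.2) (closure Ω ×ˢ univ))
    (hf₂c : ContinuousOn (fun p : EuclideanSpace ℝ (Fin n) × ℝ × ℝ =>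
      f₂ p.1 p.2.1 p.2.2) (closure Ω ×ˢ univ))
    (hf₁0 : ∀ x ∈ closure Ω, ∀ v₁ v₂ : ℝ, 0 ≤ f₁ x v₁ v₂)
    (hf₂0 : ∀ x ∈ closure Ω, ∀ v₁ v₂ : ℝ, 0 ≤ f₂ x v₁ v₂)
    (m₁₁ m₁₂ C₀₁ C₀₂ σ₁ σ₂ σ : ℝ)
    (hm₁₁ : m₁₁ = sInf ((fun x => ψ₁₁ x ^ 2) '' Ω₀))
    (hm₁₂ : m₁₂ = sInf ((fun x => ψ₁₂ x ^ 2) '' Ω₀))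
    (hC₀₁ : C₀₁ = ∫ τ in Ω, Real.sqrt (G₁₁ τ τ) * ψ₂₁ τ ^ 2)
    (hC₀₂ : C₀₂ = ∫ τ in Ω, Real.sqrt (G₁₂ τ τ) * ψ₂₂ τ ^ 2)
    (hσ₁ : σ₁ = δ₁₁ * δ₂₁ * m₁₁ * C₀₁ / (C₁₁ * C₂₁ * Real.sqrt M₁₁ * (volume Ω).toReal))
    (hσ₂ : σ₂ = δ₁₂ * δ₂₂ * m₁₂ * C₀₂ / (C₁₂ * C₂₂ * Real.sqrt M₁₂ * (volume Ω).toReal))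
    (hσ : σ = min σ₁ σ₂)
    (u₁ u₂ : EuclideanSpace ℝ (Fin n) → ℝ)
    (hu₁ : ContinuousOn u₁ (closure Ω)) (hu₂ : ContinuousOn u₂ (closure Ω))
    (T₁ T₂ : EuclideanSpace ℝ (Fin n) → ℝ)
    (hT₁ : ∀ x, T₁ x = ∫ τ in Ω, ∫ s in Ω, G₁₁ x τ * G₂₁ τ s * f₁ s (u₁ s) (u₂ s))
    (hT₂ : ∀ x, T₂ x = ∫ τ in Ω, ∫ s in Ω, G₁₂ x τ * G₂₂ τ s * f₂ s (u₁ s) (u₂ s)) :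
    ∀ x ∈ Ω₀, σ * (sSup (T₁ '' closure Ω) + sSup (T₂ '' closure Ω)) ≤ T₁ x + T₂ x := by
  intro x hx
  obtain ⟨p1, q1⟩ := cone_aux Ω Ω₀ hΩo hΩne hΩb hΩ₀sub hΩ₀ne G₁₁ G₂₁ hG₁₁c hG₂₁c hG₁₁0 hG₂₁0
    C₁₁ C₂₁ δ₁₁ δ₂₁ hC₁₁ hC₂₁ hδ₁₁ hδ₂₁ ψ₁₁ ψ₂₁ hψ₂₁c hG₁₁bd hG₂₁bd hG₁₁lb hG₂₁lb M₁₁ hM₁₁ hM₁₁pos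
    f₁ hf₁c hf₁0 m₁₁ C₀₁ σ₁ hm₁₁ hC₀₁ hσ₁ u₁ u₂ hu₁ hu₂ T₁ hT₁
  obtain ⟨p2, q2⟩ := cone_aux Ω Ω₀ hΩo hΩne hΩb hΩ₀sub hΩ₀ne G₁₂ G₂₂ hG₁₂c hG₂₂c hG₁₂0 hG₂₂0
    C₁₂ C₂₂ δ₁₂ δ₂₂ hC₁₂ hC₂₂ hδ₁₂ hδ₂₂ ψ₁₂ ψ₂₂ hψ₂₂c hG₁₂bd hG₂₂bd hG₁₂lb hG₂₂lb M₁₂ hM₁₂ hM₁₂pos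
    f₂ hf₂c hf₂0 m₁₂ C₀₂ σ₂ hm₁₂ hC₀₂ hσ₂ u₁ u₂ hu₁ hu₂ T₂ hT₂
  have h1 : σ ≤ σ₁ := hσ ▸ min_le_left _ _
  have h2 : σ ≤ σ₂ := hσ ▸ min_le_right _ _
  rw [mul_add]
  exact add_le_add ((mul_le_mul_of_nonneg_right h1 p1).trans (q1 x hx))
    ((mul_le_mul_of_nonneg_right h2 p2).trans (q2 x hx))
end

section
/- For j = 1,2, let G_{1,j}, G_{2,j} : K × K → ℝ be continuous nonnegative kernels, let δ_{1,j}, δ_{2,j} > 0 be constants and ψ_{1,j}, ψ_{2,j} : K → ℝ continuous functions such that G_{i,j}(x,τ) ≥ δ_{i,j} ψ_{i,j}(x)² √(G_{i,j}(τ,τ)) for i = 1,2 and all x, τ ∈ K. Let f₁, f₂ : K × ℝ × ℝ → ℝ be continuous and nonnegative, let Ω₀ be a nonempty compact subset of Ω, fix x₀ ∈ Ω₀, and set m_{1,j} = inf_{x∈Ω₀} ψ_{1,j}(x)², m_{2,j} = inf_{s∈Ω₀} √(G_{2,j}(s,s)), and C_{0,j} = ∫_Ω √(G_{1,j}(τ,τ))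 ψ_{2,j}(τ)² dτ. Define T_j(u₁,u₂)(x) = ∫_Ω ∫_Ω G_{1,j}(x,τ) G_{2,j}(τ,s) f_j(s, u₁(s), u₂(s)) ds dτ. Then for all continuous u₁, u₂ : K → ℝ, T₁(u₁,u₂)(x₀) + T₂(u₁,u₂)(x₀) ≥ min_{j=1,2}{δ_{1,j} δ_{2,j} m_{1,j} m_{2,j} C_{0,j}} · ∫_{Ω₀} ( f₁(s,u₁(s),u₂(s)) + f₂(s,u₁(s),u₂(s)) ) ds. -/
open MeasureTheory Set

lemma aux_bound {n : ℕ} (Ω Ω₀ : Set (EuclideanSpace ℝ (Fin n)))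
    (hΩo : IsOpen Ω) (hΩb : Bornology.IsBounded Ω)
    (hΩ₀sub : Ω₀ ⊆ Ω) (hΩ₀c : IsCompact Ω₀)
    (x₀ : EuclideanSpace ℝ (Fin n)) (hx₀ : x₀ ∈ Ω₀)
    (G₁ G₂ : EuclideanSpace ℝ (Fin n) → EuclideanSpace ℝ (Fin n) → ℝ)
    (hG₁c : ContinuousOn (fun p => G₁ p.1 p.2) (closure Ω ×ˢ closure Ω))
    (hG₂c : ContinuousOn (fun p => G₂ p.1 p.2) (closure Ω ×ˢ closure Ω))
    (hG₁0 : ∀ x ∈ closure Ω, ∀ τ ∈ closure Ω, 0 ≤ G₁ x τ)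
    (hG₂0 : ∀ x ∈ closure Ω, ∀ τ ∈ closure Ω, 0 ≤ G₂ x τ)
    (δ₁ δ₂ : ℝ) (hδ₁ : 0 < δ₁) (hδ₂ : 0 < δ₂)
    (ψ₁ ψ₂ : EuclideanSpace ℝ (Fin n) → ℝ)
    (hψ₂c : ContinuousOn ψ₂ (closure Ω))
    (hG₁lb : ∀ x ∈ closure Ω, ∀ τ ∈ closure Ω,
      δ₁ * ψ₁ x ^ 2 * Real.sqrt (G₁ τ τ) ≤ G₁ x τ)
    (hG₂lb : ∀ x ∈ closure Ω, ∀ τ ∈ closure Ω,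
      δ₂ * ψ₂ x ^ 2 * Real.sqrt (G₂ τ τ) ≤ G₂ x τ)
    (F : EuclideanSpace ℝ (Fin n) → ℝ) (hF : ContinuousOn F (closure Ω))
    (hF0 : ∀ x ∈ closure Ω, 0 ≤ F x) :
    δ₁ * δ₂ * sInf ((fun x => ψ₁ x ^ 2) '' Ω₀) * sInf ((fun s => Real.sqrt (G₂ s s)) '' Ω₀) *
      (∫ τ in Ω, Real.sqrt (G₁ τ τ) * ψ₂ τ ^ 2) * ∫ s in Ω₀, F s ≤
      ∫ τ in Ω, ∫ s in Ω, G₁ x₀ τ * G₂ τ s * F s := by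
  have hK : IsCompact (closure Ω) := hΩb.isCompact_closure
  have hsub : Ω ⊆ closure Ω := subset_closure
  have hx : x₀ ∈ closure Ω := hsub (hΩ₀sub hx₀)
  set m₁ := sInf ((fun x => ψ₁ x ^ 2) '' Ω₀) with hm₁
  set m₂ := sInf ((fun s => Real.sqrt (G₂ s s)) '' Ω₀) with hm₂
  have h1 : m₁ ≤ ψ₁ x₀ ^ 2 :=
    csInf_le ⟨0, by rintro _ ⟨x, -, rfl⟩; positivity⟩ ⟨x₀, hx₀, rfl⟩
  have h2 : ∀ s ∈ Ω₀, m₂ ≤ Real.sqrt (G₂ s s) := fun s hs =>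
    csInf_le ⟨0, by rintro _ ⟨x, -, rfl⟩; positivity⟩ ⟨s, hs, rfl⟩
  have h20 : 0 ≤ m₂ := Real.sInf_nonneg (by rintro _ ⟨x, -, rfl⟩; positivity)
  have hFΩ : IntegrableOn F Ω := (hF.integrableOn_compact hK).mono_set hsub
  have hFΩ₀ : IntegrableOn F Ω₀ := hFΩ.mono_set hΩ₀sub
  have hI0 : 0 ≤ ∫ s in Ω₀, F s :=
    setIntegral_nonneg hΩ₀c.measurableSet fun s hs => hF0 s (hsub (hΩ₀sub hs))
  have hG₂τ : ∀ τ ∈ closure Ω, ContinuousOn (fun s => G₂ τ s) (closure Ω) := fun τ hτ =>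
    hG₂c.comp (f := fun s => (τ, s)) (by fun_prop) (fun s hs => ⟨hτ, hs⟩)
  have hG₁x : ContinuousOn (fun s => G₁ x₀ s) (closure Ω) :=
    hG₁c.comp (f := fun s => (x₀, s)) (by fun_prop) (fun s hs => ⟨hx, hs⟩)
  have hG₁d : ContinuousOn (fun s => G₁ s s) (closure Ω) :=
    hG₁c.comp (f := fun s => (s, s)) (by fun_prop) (fun s hs => ⟨hs, hs⟩)
  -- inner bound
  have hinner : ∀ τ ∈ Ω, δ₂ * ψ₂ τ ^ 2 * m₂ * ∫ s in Ω₀, F s ≤ ∫ s in Ω, G₂ τ s * F s := by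
    intro τ hτ
    have hint : IntegrableOn (fun s => G₂ τ s * F s) Ω :=
      (((hG₂τ τ (hsub hτ)).mul hF).integrableOn_compact hK).mono_set hsub
    calc δ₂ * ψ₂ τ ^ 2 * m₂ * ∫ s in Ω₀, F s = ∫ s in Ω₀, δ₂ * ψ₂ τ ^ 2 * m₂ * F s :=
          (integral_const_mul _ _).symm
      _ ≤ ∫ s in Ω₀, G₂ τ s * F s := by
          refine setIntegral_mono_on (hFΩ₀.const_mul _) (hint.mono_set hΩ₀sub)
            hΩ₀c.measurableSet fun s hs => ?_
          have hs' := hsub (hΩ₀sub hs)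
          refine mul_le_mul_of_nonneg_right ?_ (hF0 s hs')
          exact (mul_le_mul_of_nonneg_left (h2 s hs) (by positivity)).trans
            (hG₂lb τ (hsub hτ) s hs')
      _ ≤ ∫ s in Ω, G₂ τ s * F s := by
          refine setIntegral_mono_set hint ?_ hΩ₀sub.eventuallyLE
          refine (ae_restrict_iff' hΩo.measurableSet).2 (Filter.Eventually.of_forall fun s hs => ?_)
          exact mul_nonneg (hG₂0 τ (hsub hτ) s (hsub hs)) (hF0 s (hsub hs))
  have hprod : Integrable (fun p : EuclideanSpace ℝ (Fin n) × EuclideanSpace ℝ (Fin n) =>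
      G₁ x₀ p.1 * G₂ p.1 p.2 * F p.2) ((volume.restrict Ω).prod (volume.restrict Ω)) := by
    rw [Measure.prod_restrict]
    have hc : ContinuousOn (fun p : EuclideanSpace ℝ (Fin n) × EuclideanSpace ℝ (Fin n) =>
      G₁ x₀ p.1 * G₂ p.1 p.2 * F p.2) (closure Ω ×ˢ closure Ω) :=
      ((hG₁x.comp continuousOn_fst (fun p hp => hp.1)).mul hG₂c).mul
        (hF.comp continuousOn_snd (fun p hp => hp.2))
    exact (hc.integrableOn_compact (hK.prod hK)).mono_set (prod_mono hsub hsub)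
  have hout := hprod.integral_prod_left
  have hCint : IntegrableOn (fun τ => Real.sqrt (G₁ τ τ) * ψ₂ τ ^ 2) Ω :=
    ((hG₁d.sqrt.mul (hψ₂c.pow 2)).integrableOn_compact hK).mono_set hsub
  calc δ₁ * δ₂ * m₁ * m₂ * (∫ τ in Ω, Real.sqrt (G₁ τ τ) * ψ₂ τ ^ 2) * ∫ s in Ω₀, F s
      = ∫ τ in Ω, (δ₁ * δ₂ * m₁ * m₂ * ∫ s in Ω₀, F s) * (Real.sqrt (G₁ τ τ) * ψ₂ τ ^ 2) := by
        rw [integral_const_mul]; ring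
    _ ≤ _ := by
        refine setIntegral_mono_on (hCint.const_mul _) hout hΩo.measurableSet fun τ hτ => ?_
        have e : ∫ s in Ω, G₁ x₀ τ * G₂ τ s * F s = G₁ x₀ τ * ∫ s in Ω, G₂ τ s * F s := by
          simp_rw [mul_assoc]
          exact integral_const_mul _ _
        show _ ≤ ∫ s in Ω, G₁ x₀ τ * G₂ τ s * F s
        rw [e]
        have hA : δ₁ * m₁ * Real.sqrt (G₁ τ τ) ≤ G₁ x₀ τ :=
          le_trans (by gcongr) (hG₁lb x₀ hx τ (hsub hτ))
        calc _ = (δ₁ * m₁ * Real.sqrt (G₁ τ τ)) * (δ₂ * ψ₂ τ ^ 2 * m₂ * ∫ s in Ω₀, F s) := by ring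
          _ ≤ _ := mul_le_mul hA (hinner τ hτ) (by positivity) (hG₁0 x₀ hx τ (hsub hτ))

/-- Pointwise lower bound for the integral operator `T = (T₁,T₂)` at a point
`x₀ ∈ Ω₀`:
`T₁(u₁,u₂)(x₀) + T₂(u₁,u₂)(x₀) ≥ min_j {δ_{1,j} δ_{2,j} m_{1,j} m_{2,j} C_{0,j}}
  ∫_{Ω₀} (f₁ + f₂)`. -/
theorem stmt_13 {n : ℕ} (Ω Ω₀ : Set (EuclideanSpace ℝ (Fin n)))
    (hΩo : IsOpen Ω) (hΩne : Ω.Nonempty) (hΩb : Bornology.IsBounded Ω)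
    (hΩ₀sub : Ω₀ ⊆ Ω) (hΩ₀ne : Ω₀.Nonempty) (hΩ₀c : IsCompact Ω₀)
    (x₀ : EuclideanSpace ℝ (Fin n)) (hx₀ : x₀ ∈ Ω₀)
    (G₁₁ G₂₁ G₁₂ G₂₂ : EuclideanSpace ℝ (Fin n) → EuclideanSpace ℝ (Fin n) → ℝ)
    (hG₁₁c : ContinuousOn (fun p => G₁₁ p.1 p.2) (closure Ω ×ˢ closure Ω))
    (hG₂₁c : ContinuousOn (fun p => G₂₁ p.1 p.2) (closure Ω ×ˢ closure Ω))
    (hG₁₂c : ContinuousOn (fun p => G₁₂ p.1 p.2) (closure Ω ×ˢ closure Ω))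
    (hG₂₂c : ContinuousOn (fun p => G₂₂ p.1 p.2) (closure Ω ×ˢ closure Ω))
    (hG₁₁0 : ∀ x ∈ closure Ω, ∀ τ ∈ closure Ω, 0 ≤ G₁₁ x τ)
    (hG₂₁0 : ∀ x ∈ closure Ω, ∀ τ ∈ closure Ω, 0 ≤ G₂₁ x τ)
    (hG₁₂0 : ∀ x ∈ closure Ω, ∀ τ ∈ closure Ω, 0 ≤ G₁₂ x τ)
    (hG₂₂0 : ∀ x ∈ closure Ω, ∀ τ ∈ closure Ω, 0 ≤ G₂₂ x τ)
    (δ₁₁ δ₂₁ δ₁₂ δ₂₂ : ℝ)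
    (hδ₁₁ : 0 < δ₁₁) (hδ₂₁ : 0 < δ₂₁) (hδ₁₂ : 0 < δ₁₂) (hδ₂₂ : 0 < δ₂₂)
    (ψ₁₁ ψ₂₁ ψ₁₂ ψ₂₂ : EuclideanSpace ℝ (Fin n) → ℝ)
    (hψ₁₁c : ContinuousOn ψ₁₁ (closure Ω)) (hψ₂₁c : ContinuousOn ψ₂₁ (closure Ω))
    (hψ₁₂c : ContinuousOn ψ₁₂ (closure Ω)) (hψ₂₂c : ContinuousOn ψ₂₂ (closure Ω))
    (hG₁₁lb : ∀ x ∈ closure Ω, ∀ τ ∈ closure Ω,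
      δ₁₁ * ψ₁₁ x ^ 2 * Real.sqrt (G₁₁ τ τ) ≤ G₁₁ x τ)
    (hG₂₁lb : ∀ x ∈ closure Ω, ∀ τ ∈ closure Ω,
      δ₂₁ * ψ₂₁ x ^ 2 * Real.sqrt (G₂₁ τ τ) ≤ G₂₁ x τ)
    (hG₁₂lb : ∀ x ∈ closure Ω, ∀ τ ∈ closure Ω,
      δ₁₂ * ψ₁₂ x ^ 2 * Real.sqrt (G₁₂ τ τ) ≤ G₁₂ x τ)
    (hG₂₂lb : ∀ x ∈ closure Ω, ∀ τ ∈ closure Ω,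
      δ₂₂ * ψ₂₂ x ^ 2 * Real.sqrt (G₂₂ τ τ) ≤ G₂₂ x τ)
    (f₁ f₂ : EuclideanSpace ℝ (Fin n) → ℝ → ℝ → ℝ)
    (hf₁c : ContinuousOn (fun p : EuclideanSpace ℝ (Fin n) × ℝ × ℝ =>
      f₁ p.1 p.2.1 p.2.2) (closure Ω ×ˢ univ))
    (hf₂c : ContinuousOn (fun p : EuclideanSpace ℝ (Fin n) × ℝ × ℝ =>
      f₂ p.1 p.2.1 p.2.2) (closure Ω ×ˢ univ))
    (hf₁0 : ∀ x ∈ closure Ω, ∀ v₁ v₂ : ℝ, 0 ≤ f₁ x v₁ v₂)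
    (hf₂0 : ∀ x ∈ closure Ω, ∀ v₁ v₂ : ℝ, 0 ≤ f₂ x v₁ v₂)
    (m₁₁ m₁₂ m₂₁ m₂₂ C₀₁ C₀₂ : ℝ)
    (hm₁₁ : m₁₁ = sInf ((fun x => ψ₁₁ x ^ 2) '' Ω₀))
    (hm₁₂ : m₁₂ = sInf ((fun x => ψ₁₂ x ^ 2) '' Ω₀))
    (hm₂₁ : m₂₁ = sInf ((fun s => Real.sqrt (G₂₁ s s)) '' Ω₀))
    (hm₂₂ : m₂₂ = sInf ((fun s => Real.sqrt (G₂₂ s s)) '' Ω₀))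
    (hC₀₁ : C₀₁ = ∫ τ in Ω, Real.sqrt (G₁₁ τ τ) * ψ₂₁ τ ^ 2)
    (hC₀₂ : C₀₂ = ∫ τ in Ω, Real.sqrt (G₁₂ τ τ) * ψ₂₂ τ ^ 2)
    (u₁ u₂ : EuclideanSpace ℝ (Fin n) → ℝ)
    (hu₁ : ContinuousOn u₁ (closure Ω)) (hu₂ : ContinuousOn u₂ (closure Ω))
    (T₁ T₂ : EuclideanSpace ℝ (Fin n) → ℝ)
    (hT₁ : ∀ x, T₁ x = ∫ τ in Ω, ∫ s in Ω, G₁₁ x τ * G₂₁ τ s * f₁ s (u₁ s) (u₂ s))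
    (hT₂ : ∀ x, T₂ x = ∫ τ in Ω, ∫ s in Ω, G₁₂ x τ * G₂₂ τ s * f₂ s (u₁ s) (u₂ s)) :
    min (δ₁₁ * δ₂₁ * m₁₁ * m₂₁ * C₀₁) (δ₁₂ * δ₂₂ * m₁₂ * m₂₂ * C₀₂) *
        ∫ s in Ω₀, (f₁ s (u₁ s) (u₂ s) + f₂ s (u₁ s) (u₂ s)) ≤
      T₁ x₀ + T₂ x₀ := by
  have hK : IsCompact (closure Ω) := hΩb.isCompact_closure
  have hsub : Ω₀ ⊆ closure Ω := hΩ₀sub.trans subset_closure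
  have hF₁ : ContinuousOn (fun s => f₁ s (u₁ s) (u₂ s)) (closure Ω) :=
    hf₁c.comp (f := fun s => (s, u₁ s, u₂ s)) (continuousOn_id.prodMk (hu₁.prodMk hu₂))
      (fun s hs => ⟨hs, mem_univ _⟩)
  have hF₂ : ContinuousOn (fun s => f₂ s (u₁ s) (u₂ s)) (closure Ω) :=
    hf₂c.comp (f := fun s => (s, u₁ s, u₂ s)) (continuousOn_id.prodMk (hu₁.prodMk hu₂))
      (fun s hs => ⟨hs, mem_univ _⟩)
  have b₁ := aux_bound Ω Ω₀ hΩo hΩb hΩ₀sub hΩ₀c x₀ hx₀ G₁₁ G₂₁ hG₁₁c hG₂₁c hG₁₁0 hG₂₁0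
    δ₁₁ δ₂₁ hδ₁₁ hδ₂₁ ψ₁₁ ψ₂₁ hψ₂₁c hG₁₁lb hG₂₁lb _ hF₁ (fun x hx => hf₁0 x hx _ _)
  have b₂ := aux_bound Ω Ω₀ hΩo hΩb hΩ₀sub hΩ₀c x₀ hx₀ G₁₂ G₂₂ hG₁₂c hG₂₂c hG₁₂0 hG₂₂0
    δ₁₂ δ₂₂ hδ₁₂ hδ₂₂ ψ₁₂ ψ₂₂ hψ₂₂c hG₁₂lb hG₂₂lb _ hF₂ (fun x hx => hf₂0 x hx _ _)
  have i₁ : 0 ≤ ∫ s in Ω₀, f₁ s (u₁ s) (u₂ s) :=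
    setIntegral_nonneg hΩ₀c.measurableSet fun s hs => hf₁0 s (hsub hs) _ _
  have i₂ : 0 ≤ ∫ s in Ω₀, f₂ s (u₁ s) (u₂ s) :=
    setIntegral_nonneg hΩ₀c.measurableSet fun s hs => hf₂0 s (hsub hs) _ _
  rw [← hT₁, ← hm₁₁, ← hm₂₁, ← hC₀₁] at b₁
  rw [← hT₂, ← hm₁₂, ← hm₂₂, ← hC₀₂] at b₂
  rw [integral_add ((hF₁.integrableOn_compact hK).mono_set hsub)
    ((hF₂.integrableOn_compact hK).mono_set hsub), mul_add]
  exact add_le_add ((mul_le_mul_of_nonneg_right (min_le_left _ _) i₁).trans b₁)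
    ((mul_le_mul_of_nonneg_right (min_le_right _ _) i₂).trans b₂)
end
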